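/- arXiv:2310.02717 — 8 statements merged into one kernel-verified Lean document; each statement's English description precedes it below -/
import Mathlib

section
/- Let M be a real symmetric positive definite d×d matrix, let x ∈ ℝ^d with ‖x‖₂ ≤ 1, let x₁, …, x_n ∈ ℝ^d with ‖x_s‖₂ ≤ 1 for all s, and let δ₁, …, δ_n ∈ ℝ^d with ‖δ_s‖₂ ≤ ζ for all s, where ζ ≥ 0. Then |xᵀ M⁻¹ (∑_{s=1}^n x_s x_sᵀ δ_s)| ≤ ζ √d · λ_max(∑_{s=1}^n x_s x_sᵀ) / λ_min(M) ≤ ζ √d · n / λ_min(M). -/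
open Matrix

/-- The inner product on `EuclideanSpace` is the dot product of coordinates. -/
lemma dotProduct_eq_inner {d : ℕ} (u v : EuclideanSpace ℝ (Fin d)) :
    (u : Fin d → ℝ) ⬝ᵥ v = inner ℝ u v := by
  simp [PiLp.inner_apply, dotProduct, mul_comm]

/-- The quadratic form of a real symmetric matrix in its orthonormal eigenbasis. -/
lemma dotProduct_mulVec_eq_sum_eigenvalues {d : ℕ} {A : Matrix (Fin d) (Fin d) ℝ}
    (hA : A.IsHermitian) (v : EuclideanSpace ℝ (Fin d)) :
    (v : Fin d → ℝ) ⬝ᵥ A *ᵥ v =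
      ∑ i, hA.eigenvalues i * (inner ℝ (hA.eigenvectorBasis i) v) ^ 2 := by
  have h := hA.eigenvectorBasis.sum_inner_mul_inner v (WithLp.toLp 2 (A *ᵥ v))
  rw [← dotProduct_eq_inner] at h
  rw [← h]
  refine Finset.sum_congr rfl fun i _ => ?_
  have hT : Aᵀ = A := by simpa using hA.eq
  have h2 : inner ℝ (hA.eigenvectorBasis i) (WithLp.toLp 2 (A *ᵥ v)) =
      hA.eigenvalues i * inner ℝ (hA.eigenvectorBasis i) v := by
    rw [← dotProduct_eq_inner, ← dotProduct_eq_inner, dotProduct_mulVec, ← mulVec_transpose, hT,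
      hA.mulVec_eigenvectorBasis, smul_dotProduct, smul_eq_mul]
  rw [h2, real_inner_comm]
  ring

lemma sum_inner_eigenvectorBasis_sq {d : ℕ} {A : Matrix (Fin d) (Fin d) ℝ}
    (hA : A.IsHermitian) (v : EuclideanSpace ℝ (Fin d)) :
    ∑ i, (inner ℝ (hA.eigenvectorBasis i) v) ^ 2 = ‖v‖ ^ 2 := by
  simpa using hA.eigenvectorBasis.sum_sq_norm_inner_right v

/-- Rayleigh quotient bound from above. -/
lemma dotProduct_mulVec_le_iSup_eigenvalues {d : ℕ} {A : Matrix (Fin d) (Fin d) ℝ}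
    (hA : A.IsHermitian) (v : EuclideanSpace ℝ (Fin d)) :
    (v : Fin d → ℝ) ⬝ᵥ A *ᵥ v ≤ (⨆ i, hA.eigenvalues i) * ‖v‖ ^ 2 := by
  rw [dotProduct_mulVec_eq_sum_eigenvalues hA, ← sum_inner_eigenvectorBasis_sq hA v,
    Finset.mul_sum]
  gcongr with i
  exact le_ciSup (Finite.bddAbove_range _) i

/-- Rayleigh quotient bound from below. -/
lemma iInf_eigenvalues_le_dotProduct_mulVec {d : ℕ} {A : Matrix (Fin d) (Fin d) ℝ}
    (hA : A.IsHermitian) (v : EuclideanSpace ℝ (Fin d)) :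
    (⨅ i, hA.eigenvalues i) * ‖v‖ ^ 2 ≤ (v : Fin d → ℝ) ⬝ᵥ A *ᵥ v := by
  rw [dotProduct_mulVec_eq_sum_eigenvalues hA, ← sum_inner_eigenvectorBasis_sq hA v,
    Finset.mul_sum]
  gcongr with i
  exact ciInf_le (Finite.bddBelow_range _) i

/-- The quadratic form of a Gram-type sum of rank-one matrices. -/
lemma dotProduct_sum_vecMulVec_mulVec {d n : ℕ} (xs : Fin n → EuclideanSpace ℝ (Fin d))
    (v : EuclideanSpace ℝ (Fin d)) :
    (v : Fin d → ℝ) ⬝ᵥ (∑ s, vecMulVec (xs s : Fin d → ℝ) (xs s)) *ᵥ v =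
      ∑ s, (inner ℝ v (xs s)) ^ 2 := by
  rw [sum_mulVec, dotProduct_sum]
  refine Finset.sum_congr rfl fun s _ => ?_
  rw [vecMulVec_mulVec, op_smul_eq_smul, dotProduct_smul, smul_eq_mul, dotProduct_eq_inner,
    dotProduct_eq_inner, real_inner_comm]
  ring

lemma eigenvalues_sum_vecMulVec {d n : ℕ} (xs : Fin n → EuclideanSpace ℝ (Fin d))
    (hS : (∑ s, vecMulVec (xs s : Fin d → ℝ) (xs s)).IsHermitian) (i : Fin d) :
    hS.eigenvalues i = ∑ s, (inner ℝ (hS.eigenvectorBasis i) (xs s)) ^ 2 := by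
  rw [← dotProduct_sum_vecMulVec_mulVec, hS.mulVec_eigenvectorBasis, dotProduct_smul,
    dotProduct_eq_inner, real_inner_self_eq_norm_sq]
  simp

lemma sum_norm_sq_eq_sum_eigenvalues {d n : ℕ} (xs : Fin n → EuclideanSpace ℝ (Fin d))
    (hS : (∑ s, vecMulVec (xs s : Fin d → ℝ) (xs s)).IsHermitian) :
    ∑ s, ‖xs s‖ ^ 2 = ∑ i, hS.eigenvalues i := by
  simp_rw [eigenvalues_sum_vecMulVec, ← sum_inner_eigenvectorBasis_sq hS]
  exact Finset.sum_comm

/-- **Misclustering error bound (generic form).** For a symmetric positive definite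
matrix `M`, vectors `x, x₁, …, x_n` of Euclidean norm at most `1`, and vectors
`δ₁, …, δ_n` with `‖δ_s‖₂ ≤ ζ` (`ζ ≥ 0`),
`|xᵀ M⁻¹ (∑ₛ x_s x_sᵀ δ_s)| ≤ ζ √d λ_max(∑ₛ x_s x_sᵀ) / λ_min(M) ≤ ζ √d n / λ_min(M)`. -/
theorem stmt2 {d n : ℕ} (M : Matrix (Fin d) (Fin d) ℝ) (hM : M.PosDef)
    (x : EuclideanSpace ℝ (Fin d)) (hx : ‖x‖ ≤ 1)
    (xs : Fin n → EuclideanSpace ℝ (Fin d)) (hxs : ∀ s, ‖xs s‖ ≤ 1)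
    (ζ : ℝ) (hζ : 0 ≤ ζ)
    (δ : Fin n → EuclideanSpace ℝ (Fin d)) (hδ : ∀ s, ‖δ s‖ ≤ ζ)
    (hS : (∑ s, Matrix.vecMulVec (xs s) (xs s)).IsHermitian) :
    |(x : Fin d → ℝ) ⬝ᵥ M⁻¹.mulVec (∑ s, (Matrix.vecMulVec (xs s) (xs s)).mulVec (δ s))| ≤
        ζ * Real.sqrt d * (⨆ i, hS.eigenvalues i) / (⨅ i, hM.isHermitian.eigenvalues i) ∧
      ζ * Real.sqrt d * (⨆ i, hS.eigenvalues i) / (⨅ i, hM.isHermitian.eigenvalues i) ≤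
        ζ * Real.sqrt d * n / (⨅ i, hM.isHermitian.eigenvalues i) := by
  set L := ⨆ i, hS.eigenvalues i with hL
  set m := ⨅ i, hM.isHermitian.eigenvalues i with hm
  have hL0 : 0 ≤ L := Real.iSup_nonneg fun i => by
    rw [eigenvalues_sum_vecMulVec]; positivity
  have hm0 : 0 ≤ m := Real.iInf_nonneg fun i => (hM.eigenvalues_pos i).le
  have hLn : L ≤ n := Real.iSup_le (fun i => by
    rw [eigenvalues_sum_vecMulVec]
    calc _ ≤ ∑ _s : Fin n, (1 : ℝ) := Finset.sum_le_sum fun s _ => by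
          have h := abs_real_inner_le_norm (hS.eigenvectorBasis i) (xs s)
          rw [OrthonormalBasis.norm_eq_one, one_mul] at h
          exact (sq_le_one_iff_abs_le_one _).2 (h.trans (hxs s))
      _ = n := by simp) n.cast_nonneg
  refine ⟨?_, by gcongr⟩
  obtain rfl | hd := Nat.eq_zero_or_pos d
  · simp
  have : Nonempty (Fin d) := ⟨⟨0, hd⟩⟩
  have hmpos : 0 < m := by
    obtain ⟨i, hi⟩ := exists_eq_ciInf_of_finite (f := hM.isHermitian.eigenvalues)
    rw [hm, ← hi]
    exact hM.eigenvalues_pos i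
  set y : EuclideanSpace ℝ (Fin d) := WithLp.toLp 2 (M⁻¹ *ᵥ x) with hy
  have hMy : M *ᵥ y = x := by
    rw [hy, mulVec_mulVec, mul_nonsing_inv _ ((isUnit_iff_isUnit_det M).1 hM.isUnit), one_mulVec]
  have hynorm : ‖y‖ ≤ 1 / m := by
    have h := iInf_eigenvalues_le_dotProduct_mulVec hM.isHermitian y
    rw [hMy, dotProduct_eq_inner] at h
    have h2 : inner ℝ y x ≤ ‖y‖ :=
      (real_inner_le_norm y x).trans (mul_le_of_le_one_right (norm_nonneg _) hx)
    rw [le_div_iff₀ hmpos]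
    by_contra! hc
    have hy0 : 0 < ‖y‖ := by
      by_contra! h0
      nlinarith
    nlinarith
  have hT : (M⁻¹)ᵀ = M⁻¹ := by simpa using hM.isHermitian.inv.eq
  have hrew : (x : Fin d → ℝ) ⬝ᵥ M⁻¹ *ᵥ (∑ s, vecMulVec (xs s : Fin d → ℝ) (xs s) *ᵥ (δ s)) =
      ∑ s, inner ℝ y (xs s) * inner ℝ (xs s) (δ s) := by
    rw [dotProduct_mulVec, ← mulVec_transpose, hT, dotProduct_sum]
    refine Finset.sum_congr rfl fun s _ => ?_
    rw [vecMulVec_mulVec, op_smul_eq_smul, dotProduct_smul, smul_eq_mul, dotProduct_eq_inner,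
      ← dotProduct_eq_inner y, mul_comm]
  have h1 : ∑ s, (inner ℝ y (xs s)) ^ 2 ≤ L * ‖y‖ ^ 2 := by
    rw [← dotProduct_sum_vecMulVec_mulVec]
    exact dotProduct_mulVec_le_iSup_eigenvalues hS y
  have h2 : ∑ s, (inner ℝ (xs s) (δ s)) ^ 2 ≤ ζ ^ 2 * (d * L) := by
    calc ∑ s, (inner ℝ (xs s) (δ s)) ^ 2 ≤ ∑ s, ζ ^ 2 * ‖xs s‖ ^ 2 := by
          refine Finset.sum_le_sum fun s _ => ?_
          rw [← mul_pow, ← sq_abs]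
          gcongr
          refine (abs_real_inner_le_norm _ _).trans ?_
          rw [mul_comm]
          gcongr
          exact hδ s
      _ = ζ ^ 2 * ∑ i, hS.eigenvalues i := by
          rw [← Finset.mul_sum, sum_norm_sq_eq_sum_eigenvalues xs hS]
      _ ≤ ζ ^ 2 * ∑ _i : Fin d, L := by
          gcongr with i
          exact le_ciSup (Finite.bddAbove_range _) i
      _ = ζ ^ 2 * (d * L) := by simp
  rw [hrew]
  calc |∑ s, inner ℝ y (xs s) * inner ℝ (xs s) (δ s)| ≤ ζ * √d * L * ‖y‖ := by
        refine abs_le_of_sq_le_sq ?_ (by positivity)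
        calc _ ≤ _ := Finset.sum_mul_sq_le_sq_mul_sq _ _ _
          _ ≤ (L * ‖y‖ ^ 2) * (ζ ^ 2 * (d * L)) := by gcongr
          _ = ζ ^ 2 * d * L ^ 2 * ‖y‖ ^ 2 := by ring
          _ = _ := by rw [mul_pow, mul_pow, mul_pow, Real.sq_sqrt d.cast_nonneg]
    _ ≤ ζ * √d * L * (1 / m) := by gcongr
    _ = ζ * √d * L / m := by ring
end

section
/- Let λ > 0, λ̃ > 0, ε ≥ 0, and let x₁, …, x_n ∈ ℝ^d with ‖x_s‖₂ ≤ 1 for all s, and δ₁, …, δ_n ∈ ℝ^d with ‖δ_s‖₂ ≤ 2ε√(2/λ̃) for all s. Let M be a real symmetric positive definite d×d matrix with λ_min(M) ≥ 2nλ̃ + λ. Then for every x ∈ ℝ^d with ‖x‖₂ ≤ 1, |xᵀ M⁻¹ (∑_{s=1}^n x_s x_sᵀ δ_s)| ≤ ε √(2d) / λ̃^{3/2}. -/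
open Matrix

/-- A lower bound on the eigenvalues of a real symmetric matrix bounds below the factor by which it
scales the Euclidean norm. -/
theorem Matrix.IsHermitian.mul_norm_le_norm_mulVec {ι : Type*} [Fintype ι] [DecidableEq ι]
    {M : Matrix ι ι ℝ} (hM : M.IsHermitian) {c : ℝ} (hc : 0 ≤ c) (h : ∀ i, c ≤ hM.eigenvalues i)
    (w : EuclideanSpace ℝ ι) : c * ‖w‖ ≤ ‖WithLp.toLp 2 (M *ᵥ w)‖ := by
  have inner_eq (i : ι) : inner ℝ (hM.eigenvectorBasis i) (WithLp.toLp 2 (M *ᵥ w)) =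
      hM.eigenvalues i * inner ℝ (hM.eigenvectorBasis i) w := by
    have hT : Mᵀ = M := by simpa [Matrix.IsHermitian] using hM
    have hv := hM.mulVec_eigenvectorBasis i
    simp only [EuclideanSpace.inner_eq_star_dotProduct, star_trivial]
    rw [dotProduct_comm, dotProduct_mulVec, ← mulVec_transpose, hT, hv, smul_dotProduct,
      dotProduct_comm, smul_eq_mul]
  refine le_of_sq_le_sq ?_ (norm_nonneg _)
  rw [mul_pow, ← hM.eigenvectorBasis.sum_sq_norm_inner_right w,
    ← hM.eigenvectorBasis.sum_sq_norm_inner_right (WithLp.toLp 2 (M *ᵥ w)), Finset.mul_sum]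
  refine Finset.sum_le_sum fun i _ => ?_
  rw [inner_eq, norm_mul, mul_pow, Real.norm_eq_abs (hM.eigenvalues i), sq_abs]
  have := h i
  gcongr

theorem norm_vecMulVec_self_mulVec_le {ι : Type*} [Fintype ι] {x : EuclideanSpace ℝ ι}
    (hx : ‖x‖ ≤ 1) (y : EuclideanSpace ℝ ι) :
    ‖WithLp.toLp 2 (vecMulVec x x *ᵥ y)‖ ≤ ‖y‖ := by
  have hxy : WithLp.toLp 2 (vecMulVec x x *ᵥ y) = inner ℝ x y • x := by
    ext i
    simp [vecMulVec_mulVec, EuclideanSpace.inner_eq_star_dotProduct, dotProduct_comm, mul_comm]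
  calc ‖WithLp.toLp 2 (vecMulVec x x *ᵥ y)‖ = ‖inner ℝ x y‖ * ‖x‖ := by rw [hxy, norm_smul]
    _ ≤ (‖x‖ * ‖y‖) * ‖x‖ := by gcongr; exact norm_inner_le_norm x y
    _ ≤ (1 * ‖y‖) * 1 := by gcongr
    _ = ‖y‖ := by ring

/-- **Lemma (bound of error caused by misclustering).** If `λ > 0`, `λ̃ > 0`, `ε ≥ 0`,
the vectors `x₁, …, x_n` have norm at most `1`, the vectors `δ₁, …, δ_n` satisfy
`‖δ_s‖₂ ≤ 2ε√(2/λ̃)`, and `M` is symmetric positive definite with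
`λ_min(M) ≥ 2nλ̃ + λ`, then for every `x` with `‖x‖₂ ≤ 1`,
`|xᵀ M⁻¹ (∑ₛ x_s x_sᵀ δ_s)| ≤ ε √(2d) / λ̃^{3/2}`. -/
theorem stmt3 {d n : ℕ} (lam lamt ε : ℝ) (hlam : 0 < lam) (hlamt : 0 < lamt) (hε : 0 ≤ ε)
    (xs : Fin n → EuclideanSpace ℝ (Fin d)) (hxs : ∀ s, ‖xs s‖ ≤ 1)
    (δ : Fin n → EuclideanSpace ℝ (Fin d))
    (hδ : ∀ s, ‖δ s‖ ≤ 2 * ε * Real.sqrt (2 / lamt))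
    (M : Matrix (Fin d) (Fin d) ℝ) (hM : M.PosDef)
    (hmin : 2 * n * lamt + lam ≤ ⨅ i, hM.isHermitian.eigenvalues i) :
    ∀ x : EuclideanSpace ℝ (Fin d), ‖x‖ ≤ 1 →
      |(x : Fin d → ℝ) ⬝ᵥ M⁻¹.mulVec (∑ s, (Matrix.vecMulVec (xs s) (xs s)).mulVec (δ s))| ≤
        ε * Real.sqrt (2 * d) / lamt ^ ((3 : ℝ) / 2) := by
  intro x hx
  have hc : 0 < 2 * n * lamt + lam := by positivity
  have hd : (1 : ℝ) ≤ d := by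
    rcases Nat.eq_zero_or_pos d with rfl | hd
    · rw [Real.iInf_of_isEmpty] at hmin
      linarith
    · exact_mod_cast hd
  set v : Fin d → ℝ := ∑ s, (Matrix.vecMulVec (xs s) (xs s)).mulVec (δ s) with hv
  set w : EuclideanSpace ℝ (Fin d) := WithLp.toLp 2 (M⁻¹ *ᵥ v) with hw
  have hMw : M *ᵥ w = v := by
    simp [hw, Matrix.mul_nonsing_inv _ hM.det_pos.ne'.isUnit]
  have hvnorm : ‖WithLp.toLp 2 v‖ ≤ n * (2 * ε * √(2 / lamt)) := by
    rw [hv, WithLp.toLp_sum]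
    refine (norm_sum_le_of_le _ fun s _ =>
      (norm_vecMulVec_self_mulVec_le (hxs s) (δ s)).trans (hδ s)).trans_eq ?_
    simp
  have hwnorm : (2 * n * lamt + lam) * ‖w‖ ≤ n * (2 * ε * √(2 / lamt)) := by
    refine le_trans ?_ hvnorm
    rw [← hMw]
    exact hM.isHermitian.mul_norm_le_norm_mulVec hc.le
      (fun i => hmin.trans (ciInf_le (Set.finite_range _).bddBelow i)) w
  have hbound : ‖w‖ ≤ ε * √(2 / lamt) / lamt := by
    rw [le_div_iff₀ hlamt]
    refine le_of_mul_le_mul_left ?_ hc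
    have h₁ := mul_le_mul_of_nonneg_right hwnorm hlamt.le
    have h₂ : 0 ≤ lam * (ε * √(2 / lamt)) := by positivity
    linarith
  have hpow : lamt ^ ((3 : ℝ) / 2) = lamt * √lamt := by
    rw [Real.sqrt_eq_rpow, show (3 : ℝ) / 2 = 1 + 1 / 2 by norm_num, Real.rpow_add hlamt,
      Real.rpow_one]
  calc |(x : Fin d → ℝ) ⬝ᵥ M⁻¹ *ᵥ v| = ‖inner ℝ w x‖ := by
        simp [hw, EuclideanSpace.inner_eq_star_dotProduct]
    _ ≤ ‖w‖ * ‖x‖ := norm_inner_le_norm w x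
    _ ≤ ‖w‖ * 1 := by gcongr
    _ ≤ ε * √(2 / lamt) / lamt := by rwa [mul_one]
    _ = ε * √2 / lamt ^ ((3 : ℝ) / 2) := by
        rw [hpow, Real.sqrt_div (by norm_num)]
        field_simp
    _ ≤ ε * √(2 * d) / lamt ^ ((3 : ℝ) / 2) := by
        gcongr
        linarith
end

section
/- Let λ > 0, d ≥ 1, T ≥ 1, let x₁, …, x_T ∈ ℝ^d with ‖x_t‖₂ ≤ 1 for all t, and let b₁, …, b_T ∈ {0, 1}. For 0 ≤ t ≤ T define M_t = λI + ∑_{s=1}^t b_s x_s x_sᵀ. Then ∑_{t=1}^T min{ b_t · (x_tᵀ M_{t-1}⁻¹ x_t), 1 } ≤ 2d log(1 + T/(λd)). -/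
open Matrix

lemma min_one_le_two_mul_log_one_add {u : ℝ} (hu : 0 ≤ u) :
    min u 1 ≤ 2 * Real.log (1 + u) := by
  have hlog := Real.one_sub_inv_le_log_of_pos (show 0 < 1 + u by linarith)
  suffices h : min u 1 ≤ 2 * (1 - (1 + u)⁻¹) by linarith
  have hrw : 2 * (1 - (1 + u)⁻¹) = 2 * u / (1 + u) := by field_simp; ring
  rw [hrw, le_div_iff₀ (by linarith)]
  rcases le_total u 1 with h | h
  · rw [min_eq_left h]; nlinarith
  · rw [min_eq_right h]; linarith

lemma Matrix.PosDef.log_det_le {n : Type*} [Fintype n] [DecidableEq n] [Nonempty n]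
    {A : Matrix n n ℝ} (hA : A.PosDef) :
    Real.log A.det ≤ Fintype.card n * Real.log (A.trace / Fintype.card n) := by
  have hpos := hA.eigenvalues_pos
  have hcard : (0 : ℝ) < Fintype.card n := by exact_mod_cast Fintype.card_pos
  have htrace : A.trace = ∑ i, hA.1.eigenvalues i := by
    simpa using hA.1.trace_eq_sum_eigenvalues
  have htr : 0 < A.trace := by
    rw [htrace]; exact Finset.sum_pos (fun i _ => hpos i) Finset.univ_nonempty
  have hdet : A.det = ∏ i, hA.1.eigenvalues i := by
    simpa using hA.1.det_eq_prod_eigenvalues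
  have hm : 0 < A.trace / Fintype.card n := by positivity
  have hterm : ∀ i, Real.log (hA.1.eigenvalues i) ≤
      Real.log (A.trace / Fintype.card n) +
        (hA.1.eigenvalues i / (A.trace / Fintype.card n) - 1) := fun i => by
    have h := Real.log_le_sub_one_of_pos (div_pos (hpos i) hm)
    rw [Real.log_div (hpos i).ne' hm.ne'] at h
    linarith
  rw [hdet, Real.log_prod (fun i _ => (hpos i).ne')]
  refine (Finset.sum_le_sum fun i _ => hterm i).trans_eq ?_
  rw [Finset.sum_add_distrib, Finset.sum_sub_distrib, ← Finset.sum_div, ← htrace]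
  simp only [Finset.sum_const, Finset.card_univ, nsmul_eq_mul, mul_one]
  field_simp
  ring

lemma Matrix.det_add_smul_vecMulVec {n R : Type*} [Fintype n] [DecidableEq n] [CommRing R]
    {A : Matrix n n R} (hA : IsUnit A.det) (c : R) (v : n → R) :
    (A + c • vecMulVec v v).det = A.det * (1 + c * (v ⬝ᵥ A⁻¹ *ᵥ v)) := by
  have h := det_add_replicateCol_mul_replicateRow (ι := Unit) hA (c • v) v
  rw [← vecMulVec_eq, smul_vecMulVec] at h
  rw [h, Matrix.mul_assoc, ← replicateCol_mulVec, det_unique (n := Unit), add_apply, one_apply_eq,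
    replicateRow_mul_replicateCol_apply, mulVec_smul, dotProduct_smul, smul_eq_mul]

/-- **Elliptical potential lemma with indicators.** For `λ > 0`, vectors
`x₁, …, x_T ∈ ℝ^d` of norm at most `1` and indicators `b₁, …, b_T ∈ {0,1}`, with
`M_t = λI + ∑_{s=1}^t b_s x_s x_sᵀ`, one has
`∑_{t=1}^T min{ b_t ⬝ x_tᵀ M_{t-1}⁻¹ x_t, 1 } ≤ 2d log(1 + T/(λd))`. -/
theorem stmt4 (lam : ℝ) (hlam : 0 < lam) (d T : ℕ) (hd : 1 ≤ d) (hT : 1 ≤ T)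
    (x : ℕ → EuclideanSpace ℝ (Fin d)) (hx : ∀ t ∈ Finset.Icc 1 T, ‖x t‖ ≤ 1)
    (b : ℕ → ℝ) (hb : ∀ t ∈ Finset.Icc 1 T, b t = 0 ∨ b t = 1)
    (M : ℕ → Matrix (Fin d) (Fin d) ℝ)
    (hM : ∀ t, M t = lam • (1 : Matrix (Fin d) (Fin d) ℝ) +
      ∑ s ∈ Finset.Icc 1 t, b s • Matrix.vecMulVec (x s) (x s)) :
    ∑ t ∈ Finset.Icc 1 T,
        min (b t * ((x t : Fin d → ℝ) ⬝ᵥ (M (t - 1))⁻¹.mulVec (x t))) 1 ≤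
      2 * d * Real.log (1 + T / (lam * d)) := by
  have : Nonempty (Fin d) := ⟨⟨0, hd⟩⟩
  have hd' : (0 : ℝ) < d := by exact_mod_cast hd
  have hM0 : M 0 = lam • (1 : Matrix (Fin d) (Fin d) ℝ) := by simp [hM]
  have hMsucc : ∀ n, M (n + 1) = M n + b (n + 1) • vecMulVec (x (n + 1)) (x (n + 1)) := fun n => by
    rw [hM, hM, Finset.sum_Icc_succ_top (by omega), add_assoc]
  have hb0 : ∀ n, n + 1 ≤ T → 0 ≤ b (n + 1) ∧ b (n + 1) ≤ 1 := fun n hn => by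
    rcases hb (n + 1) (Finset.mem_Icc.2 ⟨by omega, hn⟩) with h | h <;> simp [h]
  have key : ∀ n ≤ T, (M n).PosDef ∧ (M n).trace ≤ lam * d + n ∧
      ∑ t ∈ Finset.Icc 1 n,
        min (b t * ((x t : Fin d → ℝ) ⬝ᵥ (M (t - 1))⁻¹.mulVec (x t))) 1 ≤
      2 * (Real.log (M n).det - d * Real.log lam) := by
    intro n
    induction n with
    | zero =>
      intro _
      refine ⟨hM0 ▸ PosDef.one.smul hlam, ?_, ?_⟩
      · simp [hM0]
      · simp [hM0]
    | succ n ih =>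
      intro hn
      obtain ⟨hpd, htr, hsum⟩ := ih (by omega)
      obtain ⟨hbn, hbn'⟩ := hb0 n hn
      have hu : 0 ≤ b (n + 1) * ((x (n + 1) : Fin d → ℝ) ⬝ᵥ (M n)⁻¹ *ᵥ (x (n + 1))) :=
        mul_nonneg hbn (by simpa using hpd.inv.posSemidef.dotProduct_mulVec_nonneg (x (n + 1)))
      have hxn : (x (n + 1) : Fin d → ℝ) ⬝ᵥ (x (n + 1) : Fin d → ℝ) ≤ 1 := by
        have h := hx (n + 1) (Finset.mem_Icc.2 ⟨by omega, hn⟩)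
        have h2 := EuclideanSpace.real_norm_sq_eq (x (n + 1))
        have h3 : ‖x (n + 1)‖ ^ 2 ≤ 1 := pow_le_one₀ (norm_nonneg _) h
        simpa [dotProduct, ← pow_two, h2] using h3
      refine ⟨?_, ?_, ?_⟩
      · rw [hMsucc]
        refine hpd.add_posSemidef (PosSemidef.smul ?_ hbn)
        simpa using posSemidef_vecMulVec_self_star (x (n + 1) : Fin d → ℝ)
      · rw [hMsucc, trace_add, trace_smul, trace_vecMulVec, smul_eq_mul]
        push_cast
        nlinarith
      · rw [Finset.sum_Icc_succ_top (by omega), hMsucc,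
          det_add_smul_vecMulVec hpd.det_pos.ne'.isUnit,
          Real.log_mul hpd.det_pos.ne' (by positivity), Nat.add_sub_cancel]
        linarith [min_one_le_two_mul_log_one_add hu]
  obtain ⟨hpd, htr, hsum⟩ := key T le_rfl
  have hdet := hpd.log_det_le
  rw [Fintype.card_fin] at hdet
  have htr0 : 0 < (M T).trace := hpd.trace_pos
  have hmono : Real.log ((M T).trace / d) ≤ Real.log (lam * (1 + T / (lam * d))) := by
    refine Real.log_le_log (by positivity) ?_
    rw [div_le_iff₀ hd']
    refine htr.trans_eq ?_
    field_simp
  rw [Real.log_mul hlam.ne' (by positivity)] at hmono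
  nlinarith [mul_le_mul_of_nonneg_left hmono hd'.le]
end

section
/- Let λ > 0, d ≥ 1, and let x₁, …, x_n ∈ ℝ^d with ‖x_s‖₂ ≤ 1 for all s. Then det(λI + ∑_{s=1}^n x_s x_sᵀ) ≤ ((λd + n)/d)^d. -/
open Matrix

/-- **AM-GM inequality**, in the form free of roots. -/
theorem Real.prod_le_sum_div_card_pow {ι : Type*} [Fintype ι] (z : ι → ℝ) (hz : ∀ i, 0 ≤ z i) :
    ∏ i, z i ≤ ((∑ i, z i) / Fintype.card ι) ^ Fintype.card ι := by
  cases isEmpty_or_nonempty ι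
  · simp
  have hP : 0 ≤ ∏ i, z i := Finset.prod_nonneg fun i _ => hz i
  have h := Real.geom_mean_le_arith_mean Finset.univ (fun _ => 1) z (fun _ _ => zero_le_one)
    (by simp [Fintype.card_pos]) fun i _ => hz i
  simp only [Real.rpow_one, one_mul, Finset.sum_const, Finset.card_univ, nsmul_eq_mul,
    mul_one] at h
  calc ∏ i, z i = ((∏ i, z i) ^ (Fintype.card ι : ℝ)⁻¹) ^ Fintype.card ι :=
        (Real.rpow_inv_natCast_pow hP Fintype.card_ne_zero).symm
    _ ≤ _ := pow_le_pow_left₀ (Real.rpow_nonneg hP _) h _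

/-- The determinant of a positive semidefinite matrix is bounded in terms of its trace. -/
theorem Matrix.PosSemidef.det_le_trace_div_card_pow {ι : Type*} [Fintype ι] [DecidableEq ι]
    {A : Matrix ι ι ℝ} (hA : A.PosSemidef) :
    A.det ≤ (A.trace / Fintype.card ι) ^ Fintype.card ι := by
  rw [hA.isHermitian.det_eq_prod_eigenvalues, hA.isHermitian.trace_eq_sum_eigenvalues]
  exact Real.prod_le_sum_div_card_pow _ hA.eigenvalues_nonneg

/-- **Determinant bound for regularized Gram matrices.** For `λ > 0`, `d ≥ 1` and
vectors `x₁, …, x_n ∈ ℝ^d` of Euclidean norm at most `1`,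
`det(λI + ∑ₛ x_s x_sᵀ) ≤ ((λd + n)/d)^d`. -/
theorem stmt6 (lam : ℝ) (hlam : 0 < lam) (d n : ℕ) (hd : 1 ≤ d)
    (x : Fin n → EuclideanSpace ℝ (Fin d)) (hx : ∀ s, ‖x s‖ ≤ 1) :
    (lam • (1 : Matrix (Fin d) (Fin d) ℝ) +
        ∑ s, Matrix.vecMulVec (x s) (x s)).det ≤
      ((lam * d + n) / d) ^ d := by
  have hA : (lam • (1 : Matrix (Fin d) (Fin d) ℝ) +
      ∑ s, Matrix.vecMulVec (x s) (x s)).PosSemidef := by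
    refine (PosSemidef.one.smul hlam.le).add (posSemidef_sum _ fun s _ => ?_)
    simpa using posSemidef_vecMulVec_self_star (x s : Fin d → ℝ)
  have htrace : (lam • (1 : Matrix (Fin d) (Fin d) ℝ) +
      ∑ s, Matrix.vecMulVec (x s) (x s)).trace ≤ lam * d + n := by
    have hs : ∀ s, (x s : Fin d → ℝ) ⬝ᵥ x s ≤ 1 := fun s => by
      have h : (x s : Fin d → ℝ) ⬝ᵥ x s = ‖x s‖ ^ 2 := by
        rw [EuclideanSpace.real_norm_sq_eq]
        simp only [dotProduct, sq]
      rw [h]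
      exact pow_le_one₀ (norm_nonneg _) (hx s)
    have hsum := Finset.sum_le_sum fun s (_ : s ∈ Finset.univ) => hs s
    simpa [trace_sum, trace_vecMulVec] using hsum
  have hdet := hA.det_le_trace_div_card_pow
  rw [Fintype.card_fin] at hdet
  exact hdet.trans (pow_le_pow_left₀ (div_nonneg hA.trace_nonneg d.cast_nonneg)
    (div_le_div_of_nonneg_right htrace d.cast_nonneg) d)
end

section
/- Let λ > 0, θ ∈ ℝ^d with ‖θ‖₂ ≤ 1, x₁, …, x_n ∈ ℝ^d with ‖x_s‖₂ ≤ 1, real numbers ε₁, …, ε_n with |ε_s| ≤ ε* for all s (ε* ≥ 0), and real numbers η₁, …, η_n. Define r_s = x_sᵀθ + ε_s + η_s, M̃ = λI + ∑_{s=1}^n x_s x_sᵀ, and θ̂ = M̃⁻¹ (∑_{s=1}^n r_s x_s). Then ‖θ̂ − θ‖₂ ≤ (√λ + ε*√n + ‖∑_{s=1}^n η_s x_s‖_{M̃⁻¹}) / √(λ_min(M̃)). -/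
open Matrix

theorem Matrix.IsHermitian.iInf_eigenvalues_mul_le {m : Type*} [Fintype m] [DecidableEq m]
    {A : Matrix m m ℝ} (hA : A.IsHermitian) (v : m → ℝ) :
    (⨅ i, hA.eigenvalues i) * (v ⬝ᵥ v) ≤ v ⬝ᵥ A *ᵥ v := by
  set b := hA.eigenvectorBasis
  have parseval (u w : m → ℝ) : ∑ i, (u ⬝ᵥ ⇑(b i)) * (w ⬝ᵥ ⇑(b i)) = u ⬝ᵥ w := by
    have h := b.sum_inner_mul_inner (WithLp.toLp 2 u) (WithLp.toLp 2 w)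
    simp only [EuclideanSpace.inner_eq_star_dotProduct, star_trivial] at h
    rw [dotProduct_comm u w, ← h]
    exact Finset.sum_congr rfl fun i _ => by rw [dotProduct_comm u]
  have coeff (i : m) : (A *ᵥ v) ⬝ᵥ ⇑(b i) = hA.eigenvalues i * (v ⬝ᵥ ⇑(b i)) := by
    have hT : Aᵀ = A := by simpa using hA.eq
    rw [← vecMul_transpose, hT, ← dotProduct_mulVec, hA.mulVec_eigenvectorBasis i,
      dotProduct_smul, smul_eq_mul]
  rw [← parseval v v, ← parseval v (A *ᵥ v), Finset.mul_sum]
  refine Finset.sum_le_sum fun i _ => ?_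
  rw [coeff]
  have h := ciInf_le (Set.finite_range hA.eigenvalues).bddBelow i
  nlinarith [mul_le_mul_of_nonneg_right h (mul_self_nonneg (v ⬝ᵥ ⇑(b i)))]

theorem Matrix.PosSemidef.dotProduct_mulVec_sq_le {m : Type*} [Fintype m]
    {A : Matrix m m ℝ} (hA : A.PosSemidef) (u v : m → ℝ) :
    (u ⬝ᵥ A *ᵥ v) ^ 2 ≤ (u ⬝ᵥ A *ᵥ u) * (v ⬝ᵥ A *ᵥ v) := by
  classical
  have h := LinearMap.BilinForm.apply_mul_apply_le_of_forall_zero_le (Matrix.toBilin' A)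
    (fun w => by simpa [Matrix.toBilin'_apply'] using hA.dotProduct_mulVec_nonneg w) u v
  have hT : Aᵀ = A := by simpa using hA.isHermitian.eq
  have hs : v ⬝ᵥ A *ᵥ u = u ⬝ᵥ A *ᵥ v := by
    rw [dotProduct_mulVec, ← mulVec_transpose, hT, dotProduct_comm]
  simpa only [Matrix.toBilin'_apply', hs, sq] using h

theorem dotProduct_le_sqrt_mul_sqrt {m : Type*} [Fintype m] (u v : m → ℝ) :
    u ⬝ᵥ v ≤ √(u ⬝ᵥ u) * √(v ⬝ᵥ v) := by
  simpa only [dotProduct, sq] using Real.sum_mul_le_sqrt_mul_sqrt Finset.univ u v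

theorem EuclideanSpace.norm_eq_sqrt_dotProduct {m : Type*} [Fintype m]
    (v : EuclideanSpace ℝ m) : ‖v‖ = √((v : m → ℝ) ⬝ᵥ (v : m → ℝ)) := by
  simp [EuclideanSpace.norm_eq, dotProduct, sq]

/-- **Estimation-error bound for ridge regression under misspecification.** With
`‖θ‖₂ ≤ 1`, `‖x_s‖₂ ≤ 1`, `|ε_s| ≤ ε*`, rewards `r_s = x_sᵀθ + ε_s + η_s`,
`M̃ = λI + ∑ₛ x_s x_sᵀ` and `θ̂ = M̃⁻¹ ∑ₛ r_s x_s` (`λ > 0`), one has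
`‖θ̂ − θ‖₂ ≤ (√λ + ε*√n + ‖∑ₛ η_s x_s‖_{M̃⁻¹}) / √(λ_min(M̃))`. -/
theorem stmt8 {d n : ℕ} (lam εstar : ℝ) (hlam : 0 < lam) (hεstar : 0 ≤ εstar)
    (θ : EuclideanSpace ℝ (Fin d)) (hθ : ‖θ‖ ≤ 1)
    (x : Fin n → EuclideanSpace ℝ (Fin d)) (hx : ∀ s, ‖x s‖ ≤ 1)
    (ε η : Fin n → ℝ) (hε : ∀ s, |ε s| ≤ εstar)
    (r : Fin n → ℝ) (hr : ∀ s, r s = (x s : Fin d → ℝ) ⬝ᵥ (θ : Fin d → ℝ) + ε s + η s)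
    (Mt : Matrix (Fin d) (Fin d) ℝ)
    (hMt : Mt = lam • (1 : Matrix (Fin d) (Fin d) ℝ) +
      ∑ s, Matrix.vecMulVec (x s) (x s))
    (hH : Mt.IsHermitian)
    (θhat : EuclideanSpace ℝ (Fin d))
    (hθhat : (θhat : Fin d → ℝ) = Mt⁻¹.mulVec (∑ s, r s • (x s : Fin d → ℝ))) :
    ‖θhat - θ‖ ≤
      (Real.sqrt lam + εstar * Real.sqrt n +
          Real.sqrt ((∑ s, η s • (x s : Fin d → ℝ)) ⬝ᵥ
            Mt⁻¹.mulVec (∑ s, η s • (x s : Fin d → ℝ)))) /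
        Real.sqrt (⨅ i, hH.eigenvalues i) := by
  have hsemi : (∑ s, vecMulVec (x s : Fin d → ℝ) (x s)).PosSemidef :=
    posSemidef_sum _ fun s _ => by simpa using posSemidef_vecMulVec_self_star (x s : Fin d → ℝ)
  have hpos : Mt.PosDef := hMt ▸ (PosDef.one.smul hlam).add_posSemidef hsemi
  have hdet : IsUnit Mt.det := (isUnit_iff_isUnit_det _).1 hpos.isUnit
  have hcancel (w : Fin d → ℝ) : Mt *ᵥ (Mt⁻¹ *ᵥ w) = w := by
    rw [mulVec_mulVec, mul_nonsing_inv _ hdet, one_mulVec]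
  have hmul (u : Fin d → ℝ) :
      Mt *ᵥ u = lam • u + ∑ s, ((x s : Fin d → ℝ) ⬝ᵥ u) • (x s : Fin d → ℝ) := by
    simp [hMt, add_mulVec, smul_mulVec, sum_mulVec, vecMulVec_mulVec]
  set v : Fin d → ℝ := (θhat : Fin d → ℝ) - (θ : Fin d → ℝ) with hv
  set w : Fin d → ℝ := ∑ s, η s • (x s : Fin d → ℝ) with hw
  set y : Fin n → ℝ := fun s => (x s : Fin d → ℝ) ⬝ᵥ v
  set Q : ℝ := v ⬝ᵥ Mt *ᵥ v with hQ
  set W : ℝ := w ⬝ᵥ Mt⁻¹ *ᵥ w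
  have hQ0 : 0 ≤ Q := by simpa using hpos.posSemidef.dotProduct_mulVec_nonneg v
  have hQexp : Q = lam * (v ⬝ᵥ v) + y ⬝ᵥ y := by
    rw [hQ, hmul, dotProduct_add, dotProduct_smul, dotProduct_sum, smul_eq_mul]
    congr 1
    exact Finset.sum_congr rfl fun s _ => by
      rw [dotProduct_smul, smul_eq_mul, dotProduct_comm v]
  have hMv : Mt *ᵥ v = -(lam • (θ : Fin d → ℝ)) + ∑ s, ε s • (x s : Fin d → ℝ) + w := by
    rw [hv, mulVec_sub, hθhat, hcancel, hmul, hw]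
    simp only [hr, add_smul, Finset.sum_add_distrib]
    abel
  have hQeq : Q = -(lam * (v ⬝ᵥ (θ : Fin d → ℝ))) + ε ⬝ᵥ y + w ⬝ᵥ v := by
    rw [hQ, hMv, dotProduct_add, dotProduct_add, dotProduct_neg, dotProduct_smul,
      dotProduct_sum, smul_eq_mul, dotProduct_comm v w]
    congr 2
    exact Finset.sum_congr rfl fun s _ => by
      rw [dotProduct_smul, smul_eq_mul, dotProduct_comm v]
  have hvv : 0 ≤ v ⬝ᵥ v := by simpa using dotProduct_star_self_nonneg v
  have hyy : 0 ≤ y ⬝ᵥ y := by simpa using dotProduct_star_self_nonneg y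
  have hregular : -(lam * (v ⬝ᵥ (θ : Fin d → ℝ))) ≤ √lam * √Q := by
    have h := dotProduct_le_sqrt_mul_sqrt (-v) (θ : Fin d → ℝ)
    rw [← EuclideanSpace.norm_eq_sqrt_dotProduct θ, neg_dotProduct, neg_dotProduct_neg] at h
    have h' : -(v ⬝ᵥ (θ : Fin d → ℝ)) ≤ √(v ⬝ᵥ v) :=
      h.trans (mul_le_of_le_one_right (Real.sqrt_nonneg _) hθ)
    calc -(lam * (v ⬝ᵥ (θ : Fin d → ℝ))) = lam * -(v ⬝ᵥ (θ : Fin d → ℝ)) := by ring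
      _ ≤ lam * √(v ⬝ᵥ v) := by gcongr
      _ = √lam * √(lam * (v ⬝ᵥ v)) := by
        rw [Real.sqrt_mul hlam.le, ← mul_assoc, Real.mul_self_sqrt hlam.le]
      _ ≤ √lam * √Q := by gcongr; linarith
  have hmisspec : ε ⬝ᵥ y ≤ εstar * √n * √Q := by
    have hεε : ε ⬝ᵥ ε ≤ εstar ^ 2 * n := by
      calc ε ⬝ᵥ ε ≤ ∑ _s : Fin n, εstar ^ 2 :=
            Finset.sum_le_sum fun s _ => by
              rw [← sq]; exact sq_le_sq' (abs_le.1 (hε s)).1 (abs_le.1 (hε s)).2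
        _ = εstar ^ 2 * n := by simp [mul_comm]
    calc ε ⬝ᵥ y ≤ √(ε ⬝ᵥ ε) * √(y ⬝ᵥ y) := dotProduct_le_sqrt_mul_sqrt ε y
      _ ≤ √(εstar ^ 2 * n) * √Q := by
        gcongr
        nlinarith
      _ = εstar * √n * √Q := by rw [Real.sqrt_mul (sq_nonneg _), Real.sqrt_sq hεstar]
  have hnoise : w ⬝ᵥ v ≤ √W * √Q := by
    have h := hpos.posSemidef.dotProduct_mulVec_sq_le v (Mt⁻¹ *ᵥ w)
    rw [hcancel, dotProduct_comm (Mt⁻¹ *ᵥ w) w, dotProduct_comm v w] at h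
    rw [mul_comm, ← Real.sqrt_mul hQ0]
    exact Real.le_sqrt_of_sq_le h
  have hsqrtQ : √Q ≤ √lam + εstar * √n + √W := by
    rcases (Real.sqrt_nonneg Q).eq_or_lt with h | h
    · rw [← h]; positivity
    · refine le_of_mul_le_mul_right ?_ h
      rw [Real.mul_self_sqrt hQ0]
      linarith
  have hnorm : ‖θhat - θ‖ = √(v ⬝ᵥ v) := EuclideanSpace.norm_eq_sqrt_dotProduct _
  rw [hnorm]
  rcases isEmpty_or_nonempty (Fin d) with hd | hd
  · simp [dotProduct]
  have hmin : 0 < ⨅ i, hH.eigenvalues i := by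
    obtain ⟨i, hi⟩ := exists_eq_ciInf_of_finite (f := hH.eigenvalues)
    exact hi ▸ hpos.eigenvalues_pos i
  rw [le_div_iff₀ (Real.sqrt_pos.2 hmin), mul_comm, ← Real.sqrt_mul hmin.le]
  exact (Real.sqrt_le_sqrt (hH.iInf_eigenvalues_mul_le v)).trans hsqrtQ
end

section
/- Let M be a real symmetric positive definite d×d matrix and x₁, …, x_n ∈ ℝ^d be such that M − ∑_{s=1}^n x_s x_sᵀ is positive semidefinite. Then for every x ∈ ℝ^d, ∑_{s=1}^n |xᵀ M⁻¹ x_s| ≤ √n · √(xᵀ M⁻¹ x). -/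
open Matrix

/-- If `M` dominates `∑ₛ vₛ vₛᵀ` in the Loewner order, then `∑ₛ (y · vₛ)² ≤ yᵀ M y`. -/
theorem sum_sq_dotProduct_le_of_posSemidef_sub {ι κ : Type*} [Fintype ι] [Fintype κ]
    {M : Matrix ι ι ℝ} {v : κ → ι → ℝ}
    (h : (M - ∑ s, vecMulVec (v s) (v s)).PosSemidef) (y : ι → ℝ) :
    ∑ s, (y ⬝ᵥ v s) ^ 2 ≤ y ⬝ᵥ M *ᵥ y := by
  have hy := h.dotProduct_mulVec_nonneg y
  rw [star_trivial, sub_mulVec, dotProduct_sub, sum_mulVec, dotProduct_sum, sub_nonneg] at hy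
  refine le_of_eq_of_le (Finset.sum_congr rfl fun s _ => ?_) hy
  rw [vecMulVec_mulVec, op_smul_eq_smul, dotProduct_smul, smul_eq_mul, dotProduct_comm (v s) y, sq]

/-- **Cauchy–Schwarz bound for sums of absolute inner products.** If `M` is symmetric
positive definite and `M − ∑ₛ x_s x_sᵀ` is positive semidefinite, then for every `x`,
`∑ₛ |xᵀ M⁻¹ x_s| ≤ √n √(xᵀ M⁻¹ x)`. -/
theorem stmt10 {d n : ℕ} (M : Matrix (Fin d) (Fin d) ℝ) (hM : M.PosDef)
    (xs : Fin n → EuclideanSpace ℝ (Fin d))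
    (hdom : (M - ∑ s, Matrix.vecMulVec (xs s) (xs s)).PosSemidef) :
    ∀ x : EuclideanSpace ℝ (Fin d),
      ∑ s, |(x : Fin d → ℝ) ⬝ᵥ M⁻¹.mulVec (xs s)| ≤
        Real.sqrt n * Real.sqrt ((x : Fin d → ℝ) ⬝ᵥ M⁻¹.mulVec x) := by
  intro x
  have hsymm : M⁻¹ᵀ = M⁻¹ := by simpa using hM.inv.isHermitian.eq
  have hmove (w : Fin d → ℝ) : (M⁻¹ *ᵥ x) ⬝ᵥ w = (x : Fin d → ℝ) ⬝ᵥ M⁻¹ *ᵥ w := by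
    rw [dotProduct_mulVec, ← mulVec_transpose, hsymm]
  have hdet : IsUnit M.det := (isUnit_iff_isUnit_det M).mp hM.isUnit
  have hsq := sum_sq_dotProduct_le_of_posSemidef_sub hdom (M⁻¹ *ᵥ x)
  rw [mulVec_mulVec, mul_nonsing_inv M hdet, one_mulVec, hmove] at hsq
  simp only [hmove] at hsq
  rw [← Real.sqrt_mul (Nat.cast_nonneg n)]
  refine Real.le_sqrt_of_sq_le (sq_sum_le_card_mul_sum_sq.trans ?_)
  simp only [sq_abs, Finset.card_univ, Fintype.card_fin]
  gcongr
end

section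
/- Let λ > 0, θ ∈ ℝ^d with ‖θ‖₂ ≤ 1, x₁, …, x_n ∈ ℝ^d, real numbers ε₁, …, ε_n with |ε_s| ≤ ε* for all s (ε* ≥ 0), and real numbers η₁, …, η_n. Define r_s = x_sᵀθ + ε_s + η_s, M̃ = λI + ∑_{s=1}^n x_s x_sᵀ, and θ̂ = M̃⁻¹ (∑_{s=1}^n r_s x_s). Then for every x ∈ ℝ^d, |xᵀ(θ̂ − θ)| ≤ √λ · ‖x‖_{M̃⁻¹} + ε* ∑_{s=1}^n |xᵀ M̃⁻¹ x_s| + ‖x‖_{M̃⁻¹} · ‖∑_{s=1}^n η_s x_s‖_{M̃⁻¹}. -/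
open Matrix

namespace Matrix

variable {m : Type*}

/-- Cauchy–Schwarz for the semi-inner product of a real positive semidefinite matrix. -/
theorem PosSemidef.abs_dotProduct_mulVec_le [Fintype m] {N : Matrix m m ℝ} (hN : N.PosSemidef)
    (v w : m → ℝ) :
    |v ⬝ᵥ N *ᵥ w| ≤ √(v ⬝ᵥ N *ᵥ v) * √(w ⬝ᵥ N *ᵥ w) := by
  classical
  have hnonneg (u : m → ℝ) : 0 ≤ u ⬝ᵥ N *ᵥ u := by
    simpa using hN.dotProduct_mulVec_nonneg u
  have hT : Nᵀ = N := by simpa [IsHermitian] using hN.isHermitian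
  have hsymm : w ⬝ᵥ N *ᵥ v = v ⬝ᵥ N *ᵥ w := by
    simpa [hT] using dotProduct_transpose_mulVec N w v
  have h := LinearMap.BilinForm.apply_mul_apply_le_of_forall_zero_le (toBilin' N)
    (fun u => by rw [toBilin'_apply']; exact hnonneg u) v w
  simp only [toBilin'_apply', hsymm] at h
  rw [← Real.sqrt_mul (hnonneg v)]
  exact Real.abs_le_sqrt (by rw [sq]; exact h)

/-- A shift of a positive semidefinite matrix by `c > 0` is positive definite. -/
theorem PosSemidef.posDef_smul_one_add [DecidableEq m] {A : Matrix m m ℝ} (hA : A.PosSemidef)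
    {c : ℝ} (hc : 0 < c) : (c • (1 : Matrix m m ℝ) + A).PosDef :=
  (PosDef.one.smul hc).add_posSemidef hA

/-- The inverse of `c • 1 + A`, with `A` positive semidefinite, is at most `c⁻¹ • 1`. -/
theorem PosSemidef.mul_dotProduct_inv_mulVec_le [Fintype m] [DecidableEq m]
    {A : Matrix m m ℝ} (hA : A.PosSemidef) {c : ℝ} (hc : 0 < c) (v : m → ℝ) :
    c * (v ⬝ᵥ (c • (1 : Matrix m m ℝ) + A)⁻¹ *ᵥ v) ≤ v ⬝ᵥ v := by
  have hunit := (isUnit_iff_isUnit_det _).mp (hA.posDef_smul_one_add hc).isUnit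
  set u := (c • (1 : Matrix m m ℝ) + A)⁻¹ *ᵥ v with hu
  have hv : v = c • u + A *ᵥ u := by
    have h : (c • (1 : Matrix m m ℝ) + A) *ᵥ u = v := by
      rw [hu, mulVec_mulVec, mul_nonsing_inv _ hunit, one_mulVec]
    rw [← h, add_mulVec, smul_mulVec, one_mulVec]
  have h₁ : 0 ≤ u ⬝ᵥ A *ᵥ u := by simpa using hA.dotProduct_mulVec_nonneg u
  have h₂ : 0 ≤ A *ᵥ u ⬝ᵥ A *ᵥ u := by simpa using dotProduct_star_self_nonneg (A *ᵥ u)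
  have h₃ : v ⬝ᵥ v = c * (v ⬝ᵥ u) + (c * (u ⬝ᵥ A *ᵥ u) + A *ᵥ u ⬝ᵥ A *ᵥ u) := by
    calc v ⬝ᵥ v = v ⬝ᵥ (c • u + A *ᵥ u) := by rw [← hv]
      _ = c * (v ⬝ᵥ u) + v ⬝ᵥ A *ᵥ u := by simp
      _ = c * (v ⬝ᵥ u) + (c • u + A *ᵥ u) ⬝ᵥ A *ᵥ u := by rw [← hv]
      _ = _ := by simp
  linarith [mul_nonneg hc.le h₁]

end Matrix

/-- **Pointwise concentration bound for the ridge estimator.** With `‖θ‖₂ ≤ 1`,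
`|ε_s| ≤ ε*`, rewards `r_s = x_sᵀθ + ε_s + η_s`, `M̃ = λI + ∑ₛ x_s x_sᵀ` and
`θ̂ = M̃⁻¹ ∑ₛ r_s x_s` (`λ > 0`), for every `x`,
`|xᵀ(θ̂ − θ)| ≤ √λ ‖x‖_{M̃⁻¹} + ε* ∑ₛ |xᵀ M̃⁻¹ x_s| + ‖x‖_{M̃⁻¹} ‖∑ₛ η_s x_s‖_{M̃⁻¹}`. -/
theorem stmt13 {d n : ℕ} (lam εstar : ℝ) (hlam : 0 < lam) (hεstar : 0 ≤ εstar)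
    (θ : EuclideanSpace ℝ (Fin d)) (hθ : ‖θ‖ ≤ 1)
    (x : Fin n → EuclideanSpace ℝ (Fin d))
    (ε η : Fin n → ℝ) (hε : ∀ s, |ε s| ≤ εstar)
    (r : Fin n → ℝ) (hr : ∀ s, r s = (x s : Fin d → ℝ) ⬝ᵥ (θ : Fin d → ℝ) + ε s + η s)
    (Mt : Matrix (Fin d) (Fin d) ℝ)
    (hMt : Mt = lam • (1 : Matrix (Fin d) (Fin d) ℝ) +
      ∑ s, Matrix.vecMulVec (x s) (x s))
    (θhat : EuclideanSpace ℝ (Fin d))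
    (hθhat : (θhat : Fin d → ℝ) = Mt⁻¹.mulVec (∑ s, r s • (x s : Fin d → ℝ))) :
    ∀ a : EuclideanSpace ℝ (Fin d),
      |(a : Fin d → ℝ) ⬝ᵥ ((θhat : Fin d → ℝ) - θ)| ≤
        Real.sqrt lam * Real.sqrt ((a : Fin d → ℝ) ⬝ᵥ Mt⁻¹.mulVec a) +
          εstar * ∑ s, |(a : Fin d → ℝ) ⬝ᵥ Mt⁻¹.mulVec (x s)| +
          Real.sqrt ((a : Fin d → ℝ) ⬝ᵥ Mt⁻¹.mulVec a) *
            Real.sqrt ((∑ s, η s • (x s : Fin d → ℝ)) ⬝ᵥ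
              Mt⁻¹.mulVec (∑ s, η s • (x s : Fin d → ℝ))) := by
  intro a
  set A : Matrix (Fin d) (Fin d) ℝ := ∑ s, vecMulVec (x s) (x s) with hA_def
  have hA : A.PosSemidef := posSemidef_sum _ fun s _ => by
    simpa using posSemidef_vecMulVec_self_star (x s : Fin d → ℝ)
  have hM : Mt.PosDef := hMt ▸ hA.posDef_smul_one_add hlam
  have hN : Mt⁻¹.PosSemidef := hM.inv.posSemidef
  have hunit := (isUnit_iff_isUnit_det _).mp hM.isUnit
  have hAθ : A *ᵥ (θ : Fin d → ℝ) =
      ∑ s, ((x s : Fin d → ℝ) ⬝ᵥ (θ : Fin d → ℝ)) • (x s : Fin d → ℝ) := by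
    simp [hA_def, sum_mulVec, vecMulVec_mulVec]
  have hMθ : Mt *ᵥ (θ : Fin d → ℝ) = lam • (θ : Fin d → ℝ) +
      ∑ s, ((x s : Fin d → ℝ) ⬝ᵥ (θ : Fin d → ℝ)) • (x s : Fin d → ℝ) := by
    rw [hMt, add_mulVec, smul_mulVec, one_mulVec, hAθ]
  have hθinv : (θ : Fin d → ℝ) = Mt⁻¹ *ᵥ (Mt *ᵥ (θ : Fin d → ℝ)) := by
    rw [mulVec_mulVec, nonsing_inv_mul _ hunit, one_mulVec]
  have hdiff : (θhat : Fin d → ℝ) - θ = Mt⁻¹ *ᵥ (∑ s, ε s • (x s : Fin d → ℝ)) +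
      Mt⁻¹ *ᵥ (∑ s, η s • (x s : Fin d → ℝ)) - lam • Mt⁻¹ *ᵥ (θ : Fin d → ℝ) := by
    conv_lhs => rw [hθhat, hθinv, hMθ]
    rw [← mulVec_sub, ← mulVec_smul, ← mulVec_add, ← mulVec_sub]
    congr 1
    simp only [hr, add_smul, Finset.sum_add_distrib]
    abel
  have hθsq : (θ : Fin d → ℝ) ⬝ᵥ (θ : Fin d → ℝ) ≤ 1 := by
    have h : (θ : Fin d → ℝ) ⬝ᵥ (θ : Fin d → ℝ) = ‖θ‖ ^ 2 := by
      rw [EuclideanSpace.real_norm_sq_eq]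
      simp only [dotProduct, sq]
    rw [h]
    exact pow_le_one₀ (norm_nonneg _) hθ
  have hbias : |lam * ((a : Fin d → ℝ) ⬝ᵥ Mt⁻¹ *ᵥ (θ : Fin d → ℝ))| ≤
      √lam * √((a : Fin d → ℝ) ⬝ᵥ Mt⁻¹ *ᵥ a) := by
    have hle : lam * ((θ : Fin d → ℝ) ⬝ᵥ Mt⁻¹ *ᵥ θ) ≤ 1 := by
      rw [hMt]
      exact (hA.mul_dotProduct_inv_mulVec_le hlam _).trans hθsq
    have hsqrt : √lam * √((θ : Fin d → ℝ) ⬝ᵥ Mt⁻¹ *ᵥ θ) ≤ 1 := by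
      rw [← Real.sqrt_mul hlam.le]
      exact Real.sqrt_le_one.mpr hle
    rw [abs_mul, abs_of_pos hlam]
    calc lam * |(a : Fin d → ℝ) ⬝ᵥ Mt⁻¹ *ᵥ (θ : Fin d → ℝ)|
        ≤ lam * (√((a : Fin d → ℝ) ⬝ᵥ Mt⁻¹ *ᵥ a) * √((θ : Fin d → ℝ) ⬝ᵥ Mt⁻¹ *ᵥ θ)) := by
          gcongr
          exact hN.abs_dotProduct_mulVec_le _ _
      _ = (√lam * √((a : Fin d → ℝ) ⬝ᵥ Mt⁻¹ *ᵥ a)) *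
          (√lam * √((θ : Fin d → ℝ) ⬝ᵥ Mt⁻¹ *ᵥ θ)) := by
          nth_rewrite 1 [← Real.mul_self_sqrt hlam.le]
          ring
      _ ≤ √lam * √((a : Fin d → ℝ) ⬝ᵥ Mt⁻¹ *ᵥ a) :=
          mul_le_of_le_one_right (by positivity) hsqrt
  have hmis : |(a : Fin d → ℝ) ⬝ᵥ Mt⁻¹ *ᵥ (∑ s, ε s • (x s : Fin d → ℝ))| ≤
      εstar * ∑ s, |(a : Fin d → ℝ) ⬝ᵥ Mt⁻¹ *ᵥ (x s)| := by
    simp only [mulVec_sum, mulVec_smul, dotProduct_sum, dotProduct_smul, smul_eq_mul]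
    rw [Finset.mul_sum]
    refine (Finset.abs_sum_le_sum_abs _ _).trans (Finset.sum_le_sum fun s _ => ?_)
    rw [abs_mul]
    exact mul_le_mul_of_nonneg_right (hε s) (abs_nonneg _)
  have hnoise := hN.abs_dotProduct_mulVec_le a (∑ s, η s • (x s : Fin d → ℝ))
  rw [hdiff, dotProduct_sub, dotProduct_add, dotProduct_smul, smul_eq_mul]
  refine (abs_sub _ _).trans ?_
  linarith [abs_add_le ((a : Fin d → ℝ) ⬝ᵥ Mt⁻¹ *ᵥ (∑ s, ε s • (x s : Fin d → ℝ)))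
    ((a : Fin d → ℝ) ⬝ᵥ Mt⁻¹ *ᵥ (∑ s, η s • (x s : Fin d → ℝ)))]
end

section
/- Let λ ≥ 1, d ≥ 1, T ≥ 1, and x₁, …, x_T ∈ ℝ^d with ‖x_t‖₂ ≤ 1 for all t. For 0 ≤ t ≤ T define M_t = λI + ∑_{s=1}^t x_s x_sᵀ. Then ∑_{t=1}^T ∑_{s=1}^{t−1} |x_tᵀ M_{t−1}⁻¹ x_s| ≤ T √(2d log(1 + T/(λd))). -/
open Matrix

section RegularizedGram

variable {ι n : Type*} [Fintype n] [DecidableEq n]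

/-- The regularized Gram matrix `λI + ∑_{s ∈ S} v_s v_sᵀ`. -/
def regularizedGram (lam : ℝ) (v : ι → n → ℝ) (S : Finset ι) : Matrix n n ℝ :=
  lam • (1 : Matrix n n ℝ) + ∑ s ∈ S, vecMulVec (v s) (v s)

theorem posDef_regularizedGram {lam : ℝ} (hlam : 0 < lam) (v : ι → n → ℝ) (S : Finset ι) :
    (regularizedGram lam v S).PosDef := by
  refine (PosDef.one.smul hlam).add_posSemidef (posSemidef_sum S fun s _ => ?_)
  simpa using posSemidef_vecMulVec_self_star (v s)

theorem trace_regularizedGram (lam : ℝ) (v : ι → n → ℝ) (S : Finset ι) :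
    (regularizedGram lam v S).trace = lam * Fintype.card n + ∑ s ∈ S, v s ⬝ᵥ v s := by
  simp [regularizedGram, trace_sum, trace_vecMulVec]

theorem dotProduct_regularizedGram_mulVec (lam : ℝ) (v : ι → n → ℝ) (S : Finset ι) (u : n → ℝ) :
    u ⬝ᵥ (regularizedGram lam v S *ᵥ u) = lam * (u ⬝ᵥ u) + ∑ s ∈ S, (u ⬝ᵥ v s) ^ 2 := by
  simp only [regularizedGram, add_mulVec, smul_mulVec, one_mulVec, dotProduct_add,
    dotProduct_smul, sum_mulVec, dotProduct_sum, vecMulVec_mulVec, smul_eq_mul]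
  congr 1
  refine Finset.sum_congr rfl fun s _ => ?_
  simp [dotProduct_comm (v s) u, sq]

theorem det_add_vecMulVec_self {A : Matrix n n ℝ} (hA : A.PosDef) (y : n → ℝ) :
    (A + vecMulVec y y).det = A.det * (1 + y ⬝ᵥ (A⁻¹ *ᵥ y)) := by
  rw [vecMulVec_eq Unit, det_add_replicateCol_mul_replicateRow hA.det_pos.ne'.isUnit,
    det_unique (1 + _), Matrix.mul_assoc]
  congr 2

theorem log_det_le_of_posDef [Nonempty n] {A : Matrix n n ℝ} (hA : A.PosDef) :
    Real.log A.det ≤ Fintype.card n * Real.log (A.trace / Fintype.card n) := by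
  have hcard : (0 : ℝ) < Fintype.card n := by exact_mod_cast Fintype.card_pos
  have htr := hA.isHermitian.trace_eq_sum_eigenvalues
  have hdet := hA.isHermitian.det_eq_prod_eigenvalues
  simp only [RCLike.ofReal_real_eq_id, id] at htr hdet
  have htrace : 0 < A.trace := by
    rw [htr]
    exact Finset.sum_pos (fun i _ => hA.eigenvalues_pos i) Finset.univ_nonempty
  set m := A.trace / Fintype.card n with hm
  have hmpos : 0 < m := by positivity
  have key : ∀ i, Real.log (hA.isHermitian.eigenvalues i) ≤
      Real.log m + (hA.isHermitian.eigenvalues i / m - 1) := fun i => by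
    have h := Real.log_le_sub_one_of_pos (div_pos (hA.eigenvalues_pos i) hmpos)
    rw [Real.log_div (hA.eigenvalues_pos i).ne' hmpos.ne'] at h
    linarith
  rw [hdet, Real.log_prod fun i _ => (hA.eigenvalues_pos i).ne']
  refine (Finset.sum_le_sum fun i _ => key i).trans (le_of_eq ?_)
  rw [Finset.sum_add_distrib, Finset.sum_sub_distrib, ← Finset.sum_div, ← htr]
  have : A.trace / m = Fintype.card n := by
    rw [hm]; field_simp
  simp [this]

theorem sum_abs_dotProduct_inv_mulVec_le {lam : ℝ} (hlam : 0 < lam) (v : ι → n → ℝ)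
    (S : Finset ι) (y : n → ℝ) :
    ∑ s ∈ S, |y ⬝ᵥ ((regularizedGram lam v S)⁻¹ *ᵥ v s)| ≤
      √(S.card * (y ⬝ᵥ ((regularizedGram lam v S)⁻¹ *ᵥ y))) := by
  have hA := posDef_regularizedGram hlam v S
  have hquad := dotProduct_regularizedGram_mulVec lam v S ((regularizedGram lam v S)⁻¹ *ᵥ y)
  rw [mulVec_mulVec, mul_nonsing_inv _ hA.det_pos.ne'.isUnit, one_mulVec,
    dotProduct_comm _ y] at hquad
  have hsymm : ∀ z, y ⬝ᵥ ((regularizedGram lam v S)⁻¹ *ᵥ z) =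
      ((regularizedGram lam v S)⁻¹ *ᵥ y) ⬝ᵥ z := fun z => by
    have ht : ((regularizedGram lam v S)⁻¹)ᵀ = (regularizedGram lam v S)⁻¹ := by
      simpa using hA.inv.isHermitian.eq
    rw [dotProduct_mulVec, ← mulVec_transpose, ht]
  refine Real.le_sqrt_of_sq_le (sq_sum_le_card_mul_sum_sq.trans ?_)
  refine mul_le_mul_of_nonneg_left ?_ (Nat.cast_nonneg _)
  simp only [sq_abs]
  rw [Finset.sum_congr rfl fun s _ => by rw [hsymm (v s)], hquad]
  have : 0 ≤ ((regularizedGram lam v S)⁻¹ *ᵥ y) ⬝ᵥ ((regularizedGram lam v S)⁻¹ *ᵥ y) :=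
    Finset.sum_nonneg fun i _ => mul_self_nonneg _
  nlinarith

theorem dotProduct_inv_mulVec_le_one {lam : ℝ} (hlam : 1 ≤ lam) (v : ι → n → ℝ)
    (S : Finset ι) {y : n → ℝ} (hy : y ⬝ᵥ y ≤ 1) :
    y ⬝ᵥ ((regularizedGram lam v S)⁻¹ *ᵥ y) ≤ 1 := by
  have hA := posDef_regularizedGram (one_pos.trans_le hlam) v S
  have hquad := dotProduct_regularizedGram_mulVec lam v S ((regularizedGram lam v S)⁻¹ *ᵥ y)
  rw [mulVec_mulVec, mul_nonsing_inv _ hA.det_pos.ne'.isUnit, one_mulVec,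
    dotProduct_comm _ y] at hquad
  set u := (regularizedGram lam v S)⁻¹ *ᵥ y
  have hu : 0 ≤ u ⬝ᵥ u := Finset.sum_nonneg fun i _ => mul_self_nonneg _
  have hsum : 0 ≤ ∑ s ∈ S, (u ⬝ᵥ v s) ^ 2 := Finset.sum_nonneg fun s _ => sq_nonneg _
  have hdiff : 0 ≤ (y - u) ⬝ᵥ (y - u) := Finset.sum_nonneg fun i _ => mul_self_nonneg _
  rw [sub_dotProduct, dotProduct_sub, dotProduct_sub, dotProduct_comm u y] at hdiff
  nlinarith

end RegularizedGram

theorem le_two_mul_log_one_add {w : ℝ} (h0 : 0 ≤ w) (h1 : w ≤ 1) : w ≤ 2 * Real.log (1 + w) := by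
  have h := Real.le_log_one_add_of_nonneg h0
  have : w / 2 ≤ 2 * w / (w + 2) := by
    rw [div_le_div_iff₀ (by norm_num) (by linarith)]
    nlinarith
  linarith

section EllipticPotential

variable {n : Type*} [DecidableEq n]

theorem regularizedGram_Icc_succ (lam : ℝ) (v : ℕ → n → ℝ) (t : ℕ) :
    regularizedGram lam v (Finset.Icc 1 (t + 1)) =
      regularizedGram lam v (Finset.Icc 1 t) + vecMulVec (v (t + 1)) (v (t + 1)) := by
  rw [regularizedGram, regularizedGram, Finset.sum_Icc_succ_top (by omega), add_assoc]

variable [Fintype n]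

theorem sum_log_one_add_eq_log_det {lam : ℝ} (hlam : 0 < lam) (v : ℕ → n → ℝ) (T : ℕ) :
    ∑ t ∈ Finset.Icc 1 T, Real.log
        (1 + v t ⬝ᵥ ((regularizedGram lam v (Finset.Icc 1 (t - 1)))⁻¹ *ᵥ v t)) =
      Real.log (regularizedGram lam v (Finset.Icc 1 T)).det - Fintype.card n * Real.log lam := by
  induction T with
  | zero => simp [regularizedGram]
  | succ T ih =>
    have hA := posDef_regularizedGram hlam v (Finset.Icc 1 T)
    have hw : 0 ≤ v (T + 1) ⬝ᵥ ((regularizedGram lam v (Finset.Icc 1 T))⁻¹ *ᵥ v (T + 1)) := by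
      simpa using hA.inv.posSemidef.dotProduct_mulVec_nonneg (v (T + 1))
    rw [Finset.sum_Icc_succ_top (by omega), ih, regularizedGram_Icc_succ,
      det_add_vecMulVec_self hA, Real.log_mul hA.det_pos.ne' (by positivity), Nat.add_sub_cancel]
    ring

/-- The elliptic potential lemma. -/
theorem sum_dotProduct_inv_mulVec_le [Nonempty n] {lam : ℝ} (hlam : 1 ≤ lam) (v : ℕ → n → ℝ)
    (T : ℕ) (hv : ∀ t ∈ Finset.Icc 1 T, v t ⬝ᵥ v t ≤ 1) :
    ∑ t ∈ Finset.Icc 1 T, v t ⬝ᵥ ((regularizedGram lam v (Finset.Icc 1 (t - 1)))⁻¹ *ᵥ v t) ≤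
      2 * Fintype.card n * Real.log (1 + T / (lam * Fintype.card n)) := by
  have hpos : 0 < lam := one_pos.trans_le hlam
  have hcard : (0 : ℝ) < Fintype.card n := by exact_mod_cast Fintype.card_pos
  have hA := posDef_regularizedGram hpos v (Finset.Icc 1 T)
  have htrace : (regularizedGram lam v (Finset.Icc 1 T)).trace ≤ lam * Fintype.card n + T := by
    rw [trace_regularizedGram]
    have := Finset.sum_le_sum hv
    simp at this
    linarith
  have hlog : Real.log ((regularizedGram lam v (Finset.Icc 1 T)).trace / Fintype.card n) ≤
      Real.log lam + Real.log (1 + T / (lam * Fintype.card n)) := by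
    rw [← Real.log_mul hpos.ne' (by positivity)]
    refine Real.log_le_log (div_pos hA.trace_pos hcard) ?_
    rw [div_le_iff₀ hcard]
    refine htrace.trans (le_of_eq ?_)
    field_simp
  calc _ ≤ ∑ t ∈ Finset.Icc 1 T, 2 * Real.log
        (1 + v t ⬝ᵥ ((regularizedGram lam v (Finset.Icc 1 (t - 1)))⁻¹ *ᵥ v t)) := by
        refine Finset.sum_le_sum fun t ht => le_two_mul_log_one_add ?_
          (dotProduct_inv_mulVec_le_one hlam v _ (hv t ht))
        simpa using
          (posDef_regularizedGram hpos v _).inv.posSemidef.dotProduct_mulVec_nonneg (v t)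
    _ ≤ _ := by
        rw [← Finset.mul_sum, sum_log_one_add_eq_log_det hpos, mul_assoc]
        have h1 := log_det_le_of_posDef hA
        have h2 := mul_le_mul_of_nonneg_left hlog hcard.le
        linarith

end EllipticPotential

/-- **Summed cross-term bound.** For `λ ≥ 1`, vectors `x₁, …, x_T ∈ ℝ^d` of norm at
most `1` and `M_t = λI + ∑_{s=1}^t x_s x_sᵀ`,
`∑_{t=1}^T ∑_{s=1}^{t−1} |x_tᵀ M_{t−1}⁻¹ x_s| ≤ T √(2d log(1 + T/(λd)))`. -/
theorem stmt16 (lam : ℝ) (hlam : 1 ≤ lam) (d T : ℕ) (hd : 1 ≤ d) (hT : 1 ≤ T)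
    (x : ℕ → EuclideanSpace ℝ (Fin d)) (hx : ∀ t ∈ Finset.Icc 1 T, ‖x t‖ ≤ 1)
    (M : ℕ → Matrix (Fin d) (Fin d) ℝ)
    (hM : ∀ t, M t = lam • (1 : Matrix (Fin d) (Fin d) ℝ) +
      ∑ s ∈ Finset.Icc 1 t, Matrix.vecMulVec (x s) (x s)) :
    ∑ t ∈ Finset.Icc 1 T, ∑ s ∈ Finset.Icc 1 (t - 1),
        |(x t : Fin d → ℝ) ⬝ᵥ (M (t - 1))⁻¹.mulVec (x s)| ≤
      T * Real.sqrt (2 * d * Real.log (1 + T / (lam * d))) := by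
  have : Nonempty (Fin d) := ⟨⟨0, hd⟩⟩
  have hpos : 0 < lam := one_pos.trans_le hlam
  let v : ℕ → Fin d → ℝ := fun t => x t
  have hM' : ∀ t, M t = regularizedGram lam v (Finset.Icc 1 t) := hM
  have hv : ∀ t ∈ Finset.Icc 1 T, v t ⬝ᵥ v t ≤ 1 := fun t ht => by
    have h : v t ⬝ᵥ v t = ‖x t‖ ^ 2 := by
      rw [EuclideanSpace.norm_sq_eq]
      simp [v, dotProduct, sq]
    rw [h]
    exact pow_le_one₀ (norm_nonneg _) (hx t ht)
  have hpot := sum_dotProduct_inv_mulVec_le hlam v T hv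
  rw [Fintype.card_fin] at hpot
  simp only [hM']
  set w : ℕ → ℝ := fun t =>
    v t ⬝ᵥ ((regularizedGram lam v (Finset.Icc 1 (t - 1)))⁻¹ *ᵥ v t) with hw_def
  have hw : ∀ t, 0 ≤ w t := fun t => by
    simpa using (posDef_regularizedGram hpos v _).inv.posSemidef.dotProduct_mulVec_nonneg (v t)
  calc _ ≤ ∑ t ∈ Finset.Icc 1 T, √(T * w t) := by
        refine Finset.sum_le_sum fun t ht =>
          (sum_abs_dotProduct_inv_mulVec_le hpos v (Finset.Icc 1 (t - 1)) (v t)).trans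
            (Real.sqrt_le_sqrt (mul_le_mul_of_nonneg_right ?_ (hw t)))
        rw [Finset.mem_Icc] at ht
        rw [Nat.card_Icc]
        exact_mod_cast (by omega : t - 1 + 1 - 1 ≤ T)
    _ ≤ √(T ^ 2 * ∑ t ∈ Finset.Icc 1 T, w t) := by
        refine Real.le_sqrt_of_sq_le (sq_sum_le_card_mul_sum_sq.trans (le_of_eq ?_))
        rw [Finset.sum_congr rfl fun t _ => Real.sq_sqrt (mul_nonneg (Nat.cast_nonneg T) (hw t)),
          ← Finset.mul_sum, Nat.card_Icc, Nat.add_sub_cancel]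
        ring
    _ = T * √(∑ t ∈ Finset.Icc 1 T, w t) := by
        rw [Real.sqrt_mul (by positivity), Real.sqrt_sq (Nat.cast_nonneg T)]
    _ ≤ _ := mul_le_mul_of_nonneg_left (Real.sqrt_le_sqrt hpot) (Nat.cast_nonneg T)
end
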